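/- There are no integers t ≥ 2 and a ≥ 0 satisfying (2t³ + 2t² + 2t - 1 + 2a)(2t³ + 2t² + 2t - 1 - 2a) = 4t² + 8t + 9. -/

import Mathlib

theorem stmt_9 : ¬ ∃ t a : ℤ, 2 ≤ t ∧ 0 ≤ a ∧
    (2 * t ^ 3 + 2 * t ^ 2 + 2 * t - 1 + 2 * a) * (2 * t ^ 3 + 2 * t ^ 2 + 2 * t - 1 - 2 * a) =
      4 * t ^ 2 + 8 * t + 9 := by
  rintro ⟨t, a, ht, ha, h⟩
  have ht3 : 4 * t ≤ t ^ 3 := by nlinarith [mul_nonneg (by linarith : (0:ℤ) ≤ t) (by nlinarith : (0:ℤ) ≤ t ^ 2 - 4)]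
  have hP : 0 < 2 * t ^ 3 + 2 * t ^ 2 + 2 * t - 1 + 2 * a := by nlinarith [sq_nonneg t]
  have hR : 0 < 4 * t ^ 2 + 8 * t + 9 := by nlinarith [sq_nonneg t]
  have hQ : 0 < 2 * t ^ 3 + 2 * t ^ 2 + 2 * t - 1 - 2 * a := by
    rw [← h] at hR
    exact (mul_pos_iff_of_pos_left hP).mp hR
  have hx : 0 ≤ 2 * t ^ 3 + 2 * t ^ 2 + 2 * t - 1 + 2 * a - 1 := by linarith
  have hy : 0 ≤ 2 * t ^ 3 + 2 * t ^ 2 + 2 * t - 1 - 2 * a - 1 := by linarith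
  have hxy := mul_nonneg hx hy
  linarith
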